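/- Let Δ be a Gorenstein simplicial complex of dimension n−1 and let Δ₁ ⊆ Δ be a subcomplex such that (Δ₁,∂Δ₁) is near-Gorenstein of dimension n−1. Define the complementary pair by Δ₂ = Δ ∖ (Δ₁∖∂Δ₁) and ∂Δ₂ = ∂Δ₁. Then (Δ₂,∂Δ₂) is near-Gorenstein of dimension n−1. -/

import Mathlib

open scoped Classical

noncomputable section

/-- The ring of polynomials in two non-commuting variables `a`, `b` (with rational
coefficients), in which `ab`-indices and `cd`-indices live. -/
abbrev NC := FreeAlgebra ℚ (Fin 2)

/-- The variable `a`. -/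
def va : NC := FreeAlgebra.ι ℚ 0
/-- The variable `b`. -/
def vb : NC := FreeAlgebra.ι ℚ 1
/-- `c = a + b`. -/
def vc : NC := va + vb
/-- `d = ab + ba`. -/
def vd : NC := va * vb + vb * va

/-- A `cd`-monomial, encoded as a list of booleans (`false` = `c`, `true` = `d`),
viewed inside `NC` via `c = a+b`, `d = ab+ba`. -/
def cdMonomial : List Bool → NC
  | [] => 1
  | s :: w => (if s then vd else vc) * cdMonomial w

/-- Degree of a `cd`-monomial (`c` has degree 1, `d` has degree 2). -/
def cdDeg (w : List Bool) : ℕ := (w.map fun s => if s then 2 else 1).sum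

/-- Evaluation of an integer combination of `cd`-monomials in `NC`. -/
def cdEval (f : List Bool →₀ ℤ) : NC := f.sum fun w z => (z : ℚ) • cdMonomial w

/-- The weight of a chain, computed from the (strictly increasing) list of absolute ranks
of its elements; `N` is the absolute rank of the (possibly formal) maximal element `1̂`.
For a list `[r₀, r₁, …, r_k]` this is
`(a-b)^(r₁-r₀-1) · b · (a-b)^(r₂-r₁-1) · b ⋯ b · (a-b)^(N-1-r_k)`. -/
def wtRanks (N : ℕ) : List ℕ → NC
  | [] => 1
  | [r] => (va - vb) ^ (N - 1 - r)
  | r :: s :: l => (va - vb) ^ (s - r - 1) * vb * wtRanks N (s :: l)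


/-- A finite type has a finite `WithTop`. -/
instance {α : Type*} [Fintype α] : Fintype (WithTop α) := inferInstanceAs (Fintype (Option α))

/-- A lexicographic sum of finite types is finite. -/
instance {α β : Type*} [Fintype α] [Fintype β] : Fintype (α ⊕ₗ β) :=
  inferInstanceAs (Fintype (α ⊕ β))

section Posets

variable {P : Type*} [Fintype P] [PartialOrder P]

/-- `y` is a chain of the subposet `S ⊆ P` whose minimal element is `m`, containing `m`
(chains of a poset always contain the minimal element `0̂ = m`). -/
def chainIn (S : Set P) (m : P) (y : Finset P) : Prop :=
  m ∈ y ∧ ↑y ⊆ S ∧ IsChain (· < ·) (↑y : Set P)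

/-- The `ab`-index `Ψ` of the subposet `S ⊆ P` with minimal element `m`, of rank `n`
(so the adjoined maximal element `1̂` has absolute rank `rk m + n + 1`); ranks of
elements are computed by the ambient rank function `rk`. -/
def absIndexOn (S : Set P) (m : P) (rk : P → ℕ) (n : ℕ) : NC :=
  ∑ y : Finset P,
    if chainIn S m y then wtRanks (rk m + n + 1) ((y.image rk).sort (· ≤ ·)) else 0

/-- The simplicial boundary operator relative to a chain `x`: a chain `y ⊇ x` is sent to
the signed sum of the chains `y ∖ {σ}` for `σ ∈ y ∖ x`, the sign of `σ` being determined
by its position in `y`.  Together with the grading by cardinality, this is the cellular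
(chain) complex of the order complex computing (relative) simplicial homology. -/
def bnd (x : Finset P) : (Finset P →₀ ℝ) →ₗ[ℝ] (Finset P →₀ ℝ) :=
  Finsupp.lsum ℝ fun y => LinearMap.id.smulRight
    (∑ σ ∈ y \ x, ((-1 : ℝ) ^ (y.filter fun τ => τ < σ).card) • Finsupp.single (y.erase σ) (1 : ℝ))

/-- The degree-`k` term of the cellular complex of (the order complex of) the subposet
`S` with minimal element `m`, relative to the chain `x`: the span of all chains `y ⊇ x`
in `S` with `k` elements. -/
def cellSpace (S : Set P) (m : P) (x : Finset P) (k : ℕ) : Submodule ℝ (Finset P →₀ ℝ) :=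
  Submodule.span ℝ
    {f | ∃ y : Finset P, chainIn S m y ∧ x ⊆ y ∧ y.card = k ∧ f = Finsupp.single y 1}

/-- The homological Gorenstein condition for the subposet `S ⊆ P` with minimal element
`m`, of rank `n`: the order complex is a real homology sphere, i.e. for every chain `x`
the cellular complex of the interval `[x, 1̂)` of the order complex is exact except at the
top (chains of `n+1` elements), where the homology is 1-dimensional. -/
def GorensteinOn (S : Set P) (m : P) (n : ℕ) : Prop :=
  ∀ x : Finset P, chainIn S m x → ∀ k : ℕ,
    Module.finrank ℝ ↥(LinearMap.ker (bnd x) ⊓ cellSpace S m x k) =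
      Module.finrank ℝ ↥(Submodule.map (bnd x) (cellSpace S m x (k + 1))) +
        (if k = n + 1 then 1 else 0)

/-- `S ⊆ P` is a graded (sub)poset of rank `n` with minimal element `m`: covers in `S`
increase the ambient rank `rk` by one, and all maximal elements of `S` have rank
`rk m + n`. -/
def IsGradedOn (S : Set P) (m : P) (rk : P → ℕ) (n : ℕ) : Prop :=
  m ∈ S ∧ (∀ x ∈ S, m ≤ x) ∧
    (∀ a ∈ S, ∀ b ∈ S, a < b → (¬ ∃ c ∈ S, a < c ∧ c < b) → rk b = rk a + 1) ∧
    (∀ a ∈ S, (∀ b ∈ S, ¬ a < b) → rk a = rk m + n)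

/-- `S ⊆ P` (with minimal element `m` and ambient rank function `rk`) is a Gorenstein*
poset of rank `n`. -/
def IsGorensteinStarOn (S : Set P) (m : P) (rk : P → ℕ) (n : ℕ) : Prop :=
  IsGradedOn S m rk n ∧ GorensteinOn S m n

/-- The pair `(S, B)` (with minimal element `m` and ambient rank function `rk`) is a
near-Gorenstein* poset of rank `n` with boundary `B`: `B` is an order ideal of `S` of
rank `n-1` which is Gorenstein* of rank `n-1`, and the order complex of `S` is a real
homology ball with boundary the order complex of `B`: for every chain `x` of `S`, the
cellular complex of `[x, 1̂)` is exact, except that when `x` is not a chain of `B` the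
homology at the top is 1-dimensional. -/
def IsNearGorensteinStarOn (S B : Set P) (m : P) (rk : P → ℕ) (n : ℕ) : Prop :=
  IsGradedOn S m rk n ∧ B ⊆ S ∧ (∀ σ ∈ B, ∀ τ ∈ S, τ ≤ σ → τ ∈ B) ∧
    IsGradedOn B m rk (n - 1) ∧ GorensteinOn B m (n - 1) ∧
    ∀ x : Finset P, chainIn S m x → ∀ k : ℕ,
      Module.finrank ℝ ↥(LinearMap.ker (bnd x) ⊓ cellSpace S m x k) =
        Module.finrank ℝ ↥(Submodule.map (bnd x) (cellSpace S m x (k + 1))) +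
          (if k = n + 1 ∧ ¬(↑x ⊆ B) then 1 else 0)

end Posets

end

section SimplicialComplexes

variable {V : Type*} [Fintype V] [LinearOrder V]

/-- The degree-`k` term of the cellular (simplicial chain) complex of the simplicial
complex `Δ` relative to the face `x`: the span of the faces `y ⊇ x` of `Δ` with `k`
vertices.  Together with the boundary operator `bnd x` (defined above for any finite
partial order, here the linear order of the vertex set, which fixes the orientations)
it computes the reduced simplicial homology of links. -/
noncomputable def scCell (Δ : Set (Finset V)) (x : Finset V) (k : ℕ) : Submodule ℝ (Finset V →₀ ℝ) :=
  Submodule.span ℝ {f | ∃ y ∈ Δ, x ⊆ y ∧ y.card = k ∧ f = Finsupp.single y 1}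

/-- A simplicial complex `Δ` (a set of finite subsets of the vertex set, closed under
taking subsets and containing the empty face) of dimension `n-1` is **Gorenstein** if it
is a real homology `(n-1)`-sphere: for every face `x` (including the empty face) the
reduced simplicial homology of the link of `x` is `ℝ` in the top degree and `0`
otherwise; equivalently, the cellular complex of `{y ∈ Δ | y ⊇ x}` is exact except at
the faces with `n` vertices, where the homology is 1-dimensional. -/
def SCGorenstein (Δ : Set (Finset V)) (n : ℕ) : Prop :=
  ∅ ∈ Δ ∧ (∀ y ∈ Δ, ∀ z ⊆ y, z ∈ Δ) ∧ (∀ y ∈ Δ, y.card ≤ n) ∧ (∃ y ∈ Δ, y.card = n) ∧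
    ∀ x ∈ Δ, ∀ k : ℕ,
      Module.finrank ℝ ↥(LinearMap.ker (bnd x) ⊓ scCell Δ x k) =
        Module.finrank ℝ ↥(Submodule.map (bnd x) (scCell Δ x (k + 1))) +
          (if k = n then 1 else 0)

/-- A pair `(Δ, ∂Δ)` of simplicial complexes of dimensions `n-1`, `n-2` is
**near-Gorenstein** if `Δ` is a real homology `(n-1)`-ball with boundary `∂Δ`:
`∂Δ` is a Gorenstein complex of dimension `n-2`, and for every face `x` of `Δ`
(including the empty face) the reduced homology of the link of `x` is `ℝ` in the top
degree if `x ∉ ∂Δ` and vanishes in all other cases. -/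
def SCNearGorenstein (Δ B : Set (Finset V)) (n : ℕ) : Prop :=
  ∅ ∈ Δ ∧ (∀ y ∈ Δ, ∀ z ⊆ y, z ∈ Δ) ∧ (∀ y ∈ Δ, y.card ≤ n) ∧ (∃ y ∈ Δ, y.card = n) ∧
    B ⊆ Δ ∧ (∀ y ∈ B, ∀ z ⊆ y, z ∈ B) ∧ SCGorenstein B (n - 1) ∧
    ∀ x ∈ Δ, ∀ k : ℕ,
      Module.finrank ℝ ↥(LinearMap.ker (bnd x) ⊓ scCell Δ x k) =
        Module.finrank ℝ ↥(Submodule.map (bnd x) (scCell Δ x (k + 1))) +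
          (if k = n ∧ x ∉ B then 1 else 0)

set_option linter.unusedSectionVars false

/-- The sign with which a face `z` occurs in the boundary of `insert σ z`. -/
noncomputable def incidenceSign (z : Finset V) (σ : V) : ℝ :=
  (-1) ^ (z.filter fun τ => τ < σ).card

theorem incidenceSign_mul_self (z : Finset V) (σ : V) :
    incidenceSign z σ * incidenceSign z σ = 1 := by
  rw [incidenceSign, ← mul_pow]
  simp

theorem incidenceSign_ne_zero (z : Finset V) (σ : V) : incidenceSign z σ ≠ 0 := by
  simp [incidenceSign]

theorem incidenceSign_insert {z : Finset V} {σ : V} (hσ : σ ∉ z) (τ : V) :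
    incidenceSign (insert σ z) τ = (if σ < τ then -1 else 1) * incidenceSign z τ := by
  unfold incidenceSign
  rw [Finset.filter_insert]
  split_ifs
  · rw [Finset.card_insert_of_notMem (by simp [hσ]), pow_succ]
    ring
  · simp

/-- The coefficients of a boundary. -/
theorem bnd_apply (x : Finset V) (f : Finset V →₀ ℝ) (z : Finset V) :
    bnd x f z = ∑ σ, if σ ∈ z ∨ σ ∈ x then 0 else incidenceSign z σ * f (insert σ z) := by
  induction f using Finsupp.induction_linear with
  | zero => simp
  | add f g hf hg =>
    rw [map_add, Finsupp.add_apply, hf, hg, ← Finset.sum_add_distrib]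
    refine Finset.sum_congr rfl fun σ _ => ?_
    split_ifs
    · simp
    · simp [mul_add]
  | single y a =>
    have h : bnd x (Finsupp.single y a) z =
        ∑ σ ∈ y \ x, a * (incidenceSign y σ * if y.erase σ = z then 1 else 0) := by
      simp only [bnd, Finsupp.lsum_single, LinearMap.smulRight_apply, LinearMap.id_apply,
        Finsupp.smul_apply, Finsupp.finsetSum_apply, smul_eq_mul, Finset.mul_sum,
        Finsupp.single_apply, incidenceSign]
      congr!
    rw [h, ← Finset.sum_filter_add_sum_filter_not Finset.univ (fun σ => σ ∈ y \ x)]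
    rw [Finset.filter_mem_eq_inter, Finset.univ_inter]
    rw [Finset.sum_eq_zero (s := Finset.univ.filter fun σ => σ ∉ y \ x), add_zero]
    · refine Finset.sum_congr rfl fun σ hσ => ?_
      obtain ⟨hy, hx⟩ := Finset.mem_sdiff.1 hσ
      by_cases hz : y.erase σ = z
      · subst hz
        have hs : incidenceSign y σ = incidenceSign (y.erase σ) σ := by
          conv_lhs => rw [← Finset.insert_erase hy]
          rw [incidenceSign_insert (Finset.notMem_erase σ y)]
          simp
        simp [hx, Finset.insert_erase hy, hs, mul_comm]
      · have : σ ∉ z → y ≠ insert σ z := by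
          rintro h' rfl
          exact hz (Finset.erase_insert h')
        by_cases hσz : σ ∈ z
        · simp [hz, hσz]
        · simp [hz, hσz, hx, this hσz]
    · intro σ hσ
      have hσ' : σ ∉ y \ x := (Finset.mem_filter.1 hσ).2
      by_cases hx : σ ∈ x
      · simp [hx]
      · have : y ≠ insert σ z := by
          rintro rfl
          exact hσ' (by simp [hx])
        simp [this]

theorem bnd_bnd (x : Finset V) (f : Finset V →₀ ℝ) : bnd x (bnd x f) = 0 := by
  ext z
  set A : V → V → ℝ := fun σ τ =>
    if σ ∈ z ∨ σ ∈ x ∨ τ ∈ z ∨ τ ∈ x ∨ σ = τ then 0 else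
      incidenceSign z σ * ((if σ < τ then -1 else 1) * incidenceSign z τ) *
        f (insert τ (insert σ z)) with hA
  have h1 : bnd x (bnd x f) z = ∑ σ, ∑ τ, A σ τ := by
    rw [bnd_apply]
    refine Finset.sum_congr rfl fun σ _ => ?_
    split_ifs with h
    · rw [Finset.sum_eq_zero]
      intro τ _
      rw [hA]
      exact if_pos (by tauto)
    · rw [bnd_apply, Finset.mul_sum]
      refine Finset.sum_congr rfl fun τ _ => ?_
      push Not at h
      by_cases hτ : τ ∈ insert σ z ∨ τ ∈ x
      · rw [if_pos hτ, mul_zero, hA]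
        refine (if_pos ?_).symm
        rw [Finset.mem_insert] at hτ
        tauto
      · have hn : ¬(σ ∈ z ∨ σ ∈ x ∨ τ ∈ z ∨ τ ∈ x ∨ σ = τ) := by
          rw [Finset.mem_insert] at hτ
          tauto
        simp only [hA]
        rw [if_neg hτ, incidenceSign_insert h.1, if_neg hn]
        ring
  have h2 : ∀ σ τ, A σ τ = -A τ σ := by
    intro σ τ
    simp only [hA]
    by_cases h : σ ∈ z ∨ σ ∈ x ∨ τ ∈ z ∨ τ ∈ x ∨ σ = τ
    · rw [if_pos h, if_pos (by tauto), neg_zero]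
    · have hn : ¬(τ ∈ z ∨ τ ∈ x ∨ σ ∈ z ∨ σ ∈ x ∨ τ = σ) := by tauto
      rw [if_neg h, if_neg hn, Finset.insert_comm]
      have hne : σ ≠ τ := by tauto
      rcases lt_or_gt_of_ne hne with h' | h'
      · rw [if_pos h', if_neg h'.not_gt]
        ring
      · rw [if_pos h', if_neg h'.not_gt]
        ring
  have h3 : ∑ σ, ∑ τ, A σ τ = -∑ σ, ∑ τ, A σ τ := by
    conv_lhs => rw [Finset.sum_comm]
    simp only [← Finset.sum_neg_distrib]
    exact Finset.sum_congr rfl fun σ _ => Finset.sum_congr rfl fun τ _ => h2 τ σ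
  rw [h1, Finsupp.zero_apply]
  linarith

theorem mem_scCell {Δ : Set (Finset V)} {x : Finset V} {k : ℕ} {f : Finset V →₀ ℝ} :
    f ∈ scCell Δ x k ↔ ∀ y, f y ≠ 0 → y ∈ Δ ∧ x ⊆ y ∧ y.card = k := by
  have h : scCell Δ x k = Finsupp.supported ℝ ℝ {y | y ∈ Δ ∧ x ⊆ y ∧ y.card = k} := by
    rw [Finsupp.supported_eq_span_single, scCell]
    congr 1
    ext f
    simp only [Set.mem_ofPred_eq, Set.mem_image]
    constructor
    · rintro ⟨y, h1, h2, h3, rfl⟩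
      exact ⟨y, ⟨h1, h2, h3⟩, rfl⟩
    · rintro ⟨y, ⟨h1, h2, h3⟩, rfl⟩
      exact ⟨y, h1, h2, h3, rfl⟩
  rw [h, Finsupp.mem_supported]
  exact ⟨fun h y hy => h (Finsupp.mem_support_iff.2 hy),
    fun h y hy => h y (Finsupp.mem_support_iff.1 hy)⟩

theorem single_mem_scCell {Δ : Set (Finset V)} {x y : Finset V} (hy : y ∈ Δ) (hxy : x ⊆ y) :
    Finsupp.single y 1 ∈ scCell Δ x y.card :=
  Submodule.subset_span ⟨y, hy, hxy, rfl, rfl⟩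

theorem scCell_mono {Δ Δ' : Set (Finset V)} (h : Δ ⊆ Δ') (x : Finset V) (k : ℕ) :
    scCell Δ x k ≤ scCell Δ' x k := fun _ hf =>
  mem_scCell.2 fun y hy => (mem_scCell.1 hf y hy).imp_left fun hy => h hy

theorem scCell_eq_bot {Δ : Set (Finset V)} {n k : ℕ} (h : ∀ y ∈ Δ, y.card ≤ n) (hk : n < k)
    (x : Finset V) : scCell Δ x k = ⊥ := by
  rw [eq_bot_iff]
  intro f hf
  rw [Submodule.mem_bot]
  ext y
  by_contra hy
  obtain ⟨h1, -, h3⟩ := mem_scCell.1 hf y hy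
  have := h y h1
  omega

theorem bnd_mem_scCell {Δ : Set (Finset V)} (hΔ : ∀ y ∈ Δ, ∀ z ⊆ y, z ∈ Δ) {x : Finset V} {k : ℕ}
    {f : Finset V →₀ ℝ} (hf : f ∈ scCell Δ x (k + 1)) : bnd x f ∈ scCell Δ x k := by
  rw [mem_scCell] at hf ⊢
  intro z hz
  rw [bnd_apply] at hz
  obtain ⟨σ, -, hσ⟩ := Finset.exists_ne_zero_of_sum_ne_zero hz
  split_ifs at hσ with h
  · exact absurd rfl hσ
  push Not at h
  obtain ⟨h1, h2, h3⟩ := hf _ (right_ne_zero_of_mul hσ)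
  refine ⟨hΔ _ h1 _ (Finset.subset_insert σ z), (Finset.subset_insert_iff_of_notMem h.2).1 h2, ?_⟩
  rw [Finset.card_insert_of_notMem h.1] at h3
  omega

/-- The vanishing of homology, expressed through dimensions, is exactness. -/
theorem finrank_ker_eq_iff {Δ : Set (Finset V)} (hΔ : ∀ y ∈ Δ, ∀ z ⊆ y, z ∈ Δ) (x : Finset V)
    (k : ℕ) :
    Module.finrank ℝ ↥(LinearMap.ker (bnd x) ⊓ scCell Δ x k) =
        Module.finrank ℝ ↥(Submodule.map (bnd x) (scCell Δ x (k + 1))) ↔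
      ∀ c ∈ scCell Δ x k, bnd x c = 0 → ∃ d ∈ scCell Δ x (k + 1), bnd x d = c := by
  have hle : Submodule.map (bnd x) (scCell Δ x (k + 1)) ≤
      LinearMap.ker (bnd x) ⊓ scCell Δ x k := by
    rintro _ ⟨d, hd, rfl⟩
    exact ⟨bnd_bnd x d, bnd_mem_scCell hΔ hd⟩
  constructor
  · intro h c hc hc0
    have : c ∈ Submodule.map (bnd x) (scCell Δ x (k + 1)) := by
      rw [Submodule.eq_of_le_of_finrank_eq hle h.symm]
      exact ⟨hc0, hc⟩
    exact this
  · intro h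
    rw [le_antisymm hle fun c hc => h c hc.2 hc.1]

theorem exists_smul_eq_of_finrank_ker_eq_one {Δ : Set (Finset V)} {x : Finset V} {k : ℕ}
    (h : Module.finrank ℝ ↥(LinearMap.ker (bnd x) ⊓ scCell Δ x k) = 1)
    {c e : Finset V →₀ ℝ} (hc : c ∈ scCell Δ x k) (hc0 : bnd x c = 0) (hne : c ≠ 0)
    (he : e ∈ scCell Δ x k) (he0 : bnd x e = 0) : ∃ t : ℝ, t • c = e := by
  obtain ⟨t, ht⟩ := exists_smul_eq_of_finrank_eq_one h
    (x := (⟨c, hc0, hc⟩ : ↥(LinearMap.ker (bnd x) ⊓ scCell Δ x k)))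
    (fun h' => hne (congrArg Subtype.val h')) ⟨e, he0, he⟩
  exact ⟨t, congrArg Subtype.val ht⟩

theorem exists_ne_zero_of_finrank_ker_eq_one {Δ : Set (Finset V)} {x : Finset V} {k : ℕ}
    (h : Module.finrank ℝ ↥(LinearMap.ker (bnd x) ⊓ scCell Δ x k) = 1) :
    ∃ c ∈ scCell Δ x k, bnd x c = 0 ∧ c ≠ 0 := by
  have : LinearMap.ker (bnd x) ⊓ scCell Δ x k ≠ ⊥ := by
    intro h'
    rw [h', finrank_bot] at h
    exact zero_ne_one h
  obtain ⟨c, hc, hne⟩ := Submodule.exists_mem_ne_zero_of_ne_bot this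
  exact ⟨c, hc.2, hc.1, hne⟩

theorem bnd_single_self (x : Finset V) : bnd x (Finsupp.single x 1) = 0 := by
  ext z
  rw [bnd_apply]
  refine Finset.sum_eq_zero fun σ _ => ?_
  split_ifs with h
  · rfl
  · have : x ≠ insert σ z := by
      rintro rfl
      exact h (Or.inr (Finset.mem_insert_self σ z))
    simp [this]

/-- A face whose link has no homology in degree `-1` is not maximal. -/
theorem exists_card_eq_succ_of_exact {Δ : Set (Finset V)} {x : Finset V} (hx : x ∈ Δ)
    (h : ∀ c ∈ scCell Δ x x.card, bnd x c = 0 → ∃ d ∈ scCell Δ x (x.card + 1), bnd x d = c) :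
    ∃ y ∈ Δ, x ⊆ y ∧ y.card = x.card + 1 := by
  obtain ⟨d, hd, hdx⟩ := h _ (single_mem_scCell hx subset_rfl) (bnd_single_self x)
  have : d ≠ 0 := by
    rintro rfl
    rw [map_zero] at hdx
    exact one_ne_zero (Finsupp.single_eq_zero.1 hdx.symm)
  obtain ⟨y, hy⟩ := Finsupp.ne_iff.1 this
  exact ⟨y, mem_scCell.1 hd y hy⟩

/-- If no face with fewer than `n` vertices is maximal, every face lies in one with `n` vertices. -/
theorem exists_facet {Δ : Set (Finset V)} {n : ℕ} (hn : ∀ y ∈ Δ, y.card ≤ n)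
    (h : ∀ x ∈ Δ, x.card < n → ∃ y ∈ Δ, x ⊆ y ∧ y.card = x.card + 1)
    (x : Finset V) (hx : x ∈ Δ) : ∃ y ∈ Δ, x ⊆ y ∧ y.card = n := by
  rcases (hn x hx).eq_or_lt with h' | h'
  · exact ⟨x, hx, subset_rfl, h'⟩
  · obtain ⟨y, hy, hxy, hc⟩ := h x hx h'
    obtain ⟨w, hw, hyw, hwn⟩ := exists_facet hn h y hy
    exact ⟨w, hw, hxy.trans hyw, hwn⟩
termination_by n - x.card

section Gorenstein

variable {Δ : Set (Finset V)} {n : ℕ}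

theorem SCGorenstein.exact (h : SCGorenstein Δ n) {x : Finset V} (hx : x ∈ Δ) {k : ℕ}
    (hk : k ≠ n) :
    ∀ c ∈ scCell Δ x k, bnd x c = 0 → ∃ d ∈ scCell Δ x (k + 1), bnd x d = c := by
  rw [← finrank_ker_eq_iff h.2.1]
  simpa [hk] using h.2.2.2.2 x hx k

theorem SCGorenstein.finrank_ker (h : SCGorenstein Δ n) {x : Finset V} (hx : x ∈ Δ) :
    Module.finrank ℝ ↥(LinearMap.ker (bnd x) ⊓ scCell Δ x n) = 1 := by
  have := h.2.2.2.2 x hx n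
  rw [scCell_eq_bot h.2.2.1 n.lt_succ_self, Submodule.map_bot, finrank_bot] at this
  simpa using this

theorem SCGorenstein.exists_facet (h : SCGorenstein Δ n) {x : Finset V} (hx : x ∈ Δ) :
    ∃ y ∈ Δ, x ⊆ y ∧ y.card = n :=
  _root_.exists_facet h.2.2.1
    (fun _ hy hyn => exists_card_eq_succ_of_exact hy (h.exact hy hyn.ne)) x hx

/-- Projecting a chain to the star of a larger face commutes with the boundary. -/
theorem bnd_filter_subset {x z : Finset V} (hxz : x ⊆ z) (f : Finset V →₀ ℝ) :
    bnd z (f.filter (z ⊆ ·)) = (bnd x f).filter (z ⊆ ·) := by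
  ext u
  by_cases hu : z ⊆ u
  · rw [Finsupp.filter_apply_pos _ _ hu, bnd_apply, bnd_apply]
    refine Finset.sum_congr rfl fun σ _ => ?_
    rw [Finsupp.filter_apply_pos _ _ (hu.trans (Finset.subset_insert σ u))]
    have h1 : (σ ∈ u ∨ σ ∈ z) ↔ σ ∈ u := ⟨fun h => h.elim id fun h => hu h, Or.inl⟩
    have h2 : (σ ∈ u ∨ σ ∈ x) ↔ σ ∈ u := ⟨fun h => h.elim id fun h => hu (hxz h), Or.inl⟩
    simp only [h1, h2]
  · rw [Finsupp.filter_apply_neg _ _ hu, bnd_apply]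
    refine Finset.sum_eq_zero fun σ _ => ?_
    split_ifs with h
    · rfl
    · rw [Finsupp.filter_apply_neg, mul_zero]
      intro h'
      exact hu ((Finset.subset_insert_iff_of_notMem fun hz => h (Or.inr hz)).1 h')

/-- A nonzero top-dimensional cycle of a homology sphere is supported on all facets. -/
theorem SCGorenstein.cycle_apply_ne_zero (h : SCGorenstein Δ n) (x : Finset V) (hx : x ∈ Δ)
    {c : Finset V →₀ ℝ} (hc : c ∈ scCell Δ x n) (hc0 : bnd x c = 0) (hne : c ≠ 0)
    {w : Finset V} (hw : w ∈ Δ) (hxw : x ⊆ w) (hwn : w.card = n) : c w ≠ 0 := by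
  have hstar : ∀ z ∈ Δ, x ⊆ z → z.card = x.card + 1 → (∃ y, z ⊆ y ∧ c y ≠ 0) →
      ∀ y ∈ Δ, z ⊆ y → y.card = n → c y ≠ 0 := by
    rintro z hz hxz hzc ⟨y₀, hzy₀, hcy₀⟩ y hy hzy hyn
    have hzn := h.2.2.1 z hz
    have := h.cycle_apply_ne_zero z hz (c := c.filter (z ⊆ ·)) ?_ ?_ ?_ hy hzy hyn
    · rwa [Finsupp.filter_apply_pos _ _ hzy] at this
    · rw [mem_scCell] at hc ⊢
      intro u hu
      by_cases hzu : z ⊆ u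
      · rw [Finsupp.filter_apply_pos _ _ hzu] at hu
        exact ⟨(hc u hu).1, hzu, (hc u hu).2.2⟩
      · rw [Finsupp.filter_apply_neg _ _ hzu] at hu
        exact absurd rfl hu
    · rw [bnd_filter_subset hxz, hc0, Finsupp.filter_zero]
    · refine Finsupp.ne_iff.2 ⟨y₀, ?_⟩
      rwa [Finsupp.filter_apply_pos _ _ hzy₀]
  intro hcw
  obtain ⟨w₁, hw₁⟩ := Finsupp.ne_iff.1 hne
  obtain ⟨hw₁Δ, hxw₁, hw₁n⟩ := mem_scCell.1 hc w₁ hw₁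
  have hww₁ : w ≠ w₁ := by
    rintro rfl
    exact hw₁ hcw
  have hxwne : x ≠ w := by
    rintro rfl
    exact hww₁ (Finset.eq_of_subset_of_card_le hxw₁ (by omega))
  have hxw₁ne : x ≠ w₁ := by
    rintro rfl
    exact hww₁ (Finset.eq_of_subset_of_card_le hxw (by omega)).symm
  obtain ⟨v, hvw, hvx⟩ := Finset.exists_of_ssubset (hxw.ssubset_of_ne hxwne)
  obtain ⟨v₁, hvw₁, hvx₁⟩ := Finset.exists_of_ssubset (hxw₁.ssubset_of_ne hxw₁ne)
  have hsub : insert v x ⊆ w := Finset.insert_subset hvw hxw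
  have hsub₁ : insert v₁ x ⊆ w₁ := Finset.insert_subset hvw₁ hxw₁
  have hΔ : insert v x ∈ Δ := h.2.1 _ hw _ hsub
  have hΔ₁ : insert v₁ x ∈ Δ := h.2.1 _ hw₁Δ _ hsub₁
  have hcard : (insert v x).card = x.card + 1 := Finset.card_insert_of_notMem hvx
  have hcard₁ : (insert v₁ x).card = x.card + 1 := Finset.card_insert_of_notMem hvx₁
  have hp₁ : ∃ y, insert v₁ x ⊆ y ∧ c y ≠ 0 := ⟨w₁, hsub₁, hw₁⟩
  have hp : ¬∃ y, insert v x ⊆ y ∧ c y ≠ 0 := fun hp =>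
    hstar _ hΔ (Finset.subset_insert v x) hcard hp w hw hsub hwn hcw
  have hne' : insert v x ≠ insert v₁ x := fun h' => hp (h' ▸ hp₁)
  have hbs : ∀ u ∉ x, bnd x (incidenceSign x u • Finsupp.single (insert u x) (1 : ℝ)) =
      Finsupp.single x 1 := by
    intro u hu
    ext z
    rw [map_smul, Finsupp.smul_apply, bnd_apply, smul_eq_mul]
    by_cases hzx : x = z
    · subst hzx
      rw [Finset.sum_eq_single u]
      · simp [hu, incidenceSign_mul_self]
      · intro σ _ hσ
        split_ifs with h'
        · rfl
        · have : insert u x ≠ insert σ x := by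
            intro he
            have := he ▸ Finset.mem_insert_self σ x
            simp at this
            tauto
          simp [this]
      · simp
    · rw [Finset.sum_eq_zero]
      · simp [hzx]
      · intro σ _
        split_ifs with h'
        · rfl
        · push Not at h'
          have : insert u x ≠ insert σ z := by
            intro he
            have h1 : σ ∈ insert u x := he ▸ Finset.mem_insert_self σ z
            have h2 : σ = u := by simpa [h'.2] using h1
            subst h2
            apply hzx
            rw [← Finset.erase_insert hu, he, Finset.erase_insert h'.1]
          simp [this]
  set e : Finset V →₀ ℝ := incidenceSign x v • Finsupp.single (insert v x) (1 : ℝ) -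
    incidenceSign x v₁ • Finsupp.single (insert v₁ x) (1 : ℝ) with he
  have heC : e ∈ scCell Δ x (x.card + 1) := by
    refine Submodule.sub_mem _ (Submodule.smul_mem _ _ ?_) (Submodule.smul_mem _ _ ?_)
    · exact hcard ▸ single_mem_scCell hΔ (Finset.subset_insert v x)
    · exact hcard₁ ▸ single_mem_scCell hΔ₁ (Finset.subset_insert v₁ x)
  have he0 : bnd x e = 0 := by rw [he, map_sub, hbs v hvx, hbs v₁ hvx₁, sub_self]
  by_cases hn : x.card + 1 = n
  · rw [hn] at heC
    obtain ⟨t, ht⟩ := exists_smul_eq_of_finrank_ker_eq_one (h.finrank_ker hx) hc hc0 hne heC he0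
    have hwv : insert v x = w := Finset.eq_of_subset_of_card_le hsub (by omega)
    have h1 : e w = 0 := by rw [← ht, Finsupp.smul_apply, hcw, smul_zero]
    rw [← hwv, he] at h1
    simp [hne'.symm, incidenceSign_ne_zero] at h1
  · obtain ⟨d, hd, hde⟩ := h.exact hx hn e heC he0
    set p : Finset V → Prop := fun z => ∃ y, z ⊆ y ∧ c y ≠ 0
    have hcomm : bnd x (d.filter p) = e.filter p := by
      rw [← hde]
      ext z
      by_cases hz : p z
      · rw [Finsupp.filter_apply_pos _ _ hz, bnd_apply, bnd_apply]
        refine Finset.sum_congr rfl fun σ _ => ?_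
        split_ifs with h'
        · rfl
        · push Not at h'
          congr 1
          by_cases hdz : d (insert σ z) = 0
          · by_cases hq : p (insert σ z)
            · rw [Finsupp.filter_apply_pos _ _ hq]
            · rw [Finsupp.filter_apply_neg _ _ hq, hdz]
          · obtain ⟨h1, h2, h3⟩ := mem_scCell.1 hd _ hdz
            rw [Finset.card_insert_of_notMem h'.1] at h3
            obtain ⟨y, hy, hzy, hyn⟩ := h.exists_facet h1
            have hzy' := (Finset.subset_insert σ z).trans hzy
            rw [Finsupp.filter_apply_pos]
            exact ⟨y, hzy, hstar z (h.2.1 _ hy _ hzy')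
              ((Finset.subset_insert_iff_of_notMem h'.2).1 h2) (by omega) hz y hy hzy' hyn⟩
      · rw [Finsupp.filter_apply_neg _ _ hz, bnd_apply]
        refine Finset.sum_eq_zero fun σ _ => ?_
        split_ifs with h'
        · rfl
        · rw [Finsupp.filter_apply_neg, mul_zero]
          rintro ⟨y, hy, hcy⟩
          exact hz ⟨y, (Finset.subset_insert σ z).trans hy, hcy⟩
    have hef : e.filter p = -(incidenceSign x v₁ • Finsupp.single (insert v₁ x) (1 : ℝ)) := by
      rw [he, Finsupp.filter_sub, Finsupp.filter_smul, Finsupp.filter_smul,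
        Finsupp.filter_single_of_neg (p := p) hp, Finsupp.filter_single_of_pos (p := p) hp₁,
        smul_zero, zero_sub]
    have h0 := bnd_bnd x (d.filter p)
    rw [hcomm, hef, map_neg, hbs v₁ hvx₁] at h0
    simp at h0
termination_by n - x.card

end Gorenstein

section NearGorenstein

variable {Δ B : Set (Finset V)} {n : ℕ}

theorem SCNearGorenstein.exact (h : SCNearGorenstein Δ B n) {x : Finset V} (hx : x ∈ Δ) {k : ℕ}
    (hk : ¬(k = n ∧ x ∉ B)) :
    ∀ c ∈ scCell Δ x k, bnd x c = 0 → ∃ d ∈ scCell Δ x (k + 1), bnd x d = c := by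
  rw [← finrank_ker_eq_iff h.2.1]
  simpa only [if_neg hk, add_zero] using h.2.2.2.2.2.2.2 x hx k

theorem SCNearGorenstein.cycle_eq_zero (h : SCNearGorenstein Δ B n) {x : Finset V} (hx : x ∈ B)
    {c : Finset V →₀ ℝ} (hc : c ∈ scCell Δ x n) (hc0 : bnd x c = 0) : c = 0 := by
  obtain ⟨d, hd, rfl⟩ := h.exact (h.2.2.2.2.1 hx) (fun hk => hk.2 hx) c hc hc0
  rw [scCell_eq_bot h.2.2.1 n.lt_succ_self, Submodule.mem_bot] at hd
  rw [hd, map_zero]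

theorem SCNearGorenstein.finrank_ker (h : SCNearGorenstein Δ B n) {x : Finset V} (hx : x ∈ Δ)
    (hxB : x ∉ B) : Module.finrank ℝ ↥(LinearMap.ker (bnd x) ⊓ scCell Δ x n) = 1 := by
  have := h.2.2.2.2.2.2.2 x hx n
  rw [scCell_eq_bot h.2.2.1 n.lt_succ_self, Submodule.map_bot, finrank_bot] at this
  simpa [hxB] using this

theorem SCNearGorenstein.exists_facet (h : SCNearGorenstein Δ B n) {x : Finset V} (hx : x ∈ Δ) :
    ∃ y ∈ Δ, x ⊆ y ∧ y.card = n :=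
  _root_.exists_facet h.2.2.1
    (fun _ hy hyn => exists_card_eq_succ_of_exact hy (h.exact hy fun hk => hyn.ne hk.1)) x hx

theorem SCNearGorenstein.pos (h : SCNearGorenstein Δ B n) : 0 < n := by
  obtain ⟨y, hy, -, hyc⟩ := exists_card_eq_succ_of_exact h.1
    (h.exact h.1 fun hk => hk.2 h.2.2.2.2.2.2.1.1)
  have := h.2.2.1 y hy
  omega

theorem SCNearGorenstein.card_lt (h : SCNearGorenstein Δ B n) {y : Finset V} (hy : y ∈ B) :
    y.card < n := by
  have := h.2.2.2.2.2.2.1.2.2.1 y hy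
  have := h.pos
  omega

end NearGorenstein

/-- **Proposition.** Let `Δ` be a Gorenstein simplicial complex of dimension `n-1` and
`Δ₁ ⊆ Δ` a near-Gorenstein subcomplex of the same dimension with boundary `∂Δ₁`.  Then
the complementary pair `(Δ₂, ∂Δ₂) = (Δ ∖ (Δ₁ ∖ ∂Δ₁), ∂Δ₁)` is also near-Gorenstein of
dimension `n-1`. -/
theorem scNearGorenstein_complement
    (Δ Δ₁ B₁ : Set (Finset V)) (n : ℕ)
    (hΔ : SCGorenstein Δ n) (hsub : Δ₁ ⊆ Δ)
    (h₁ : SCNearGorenstein Δ₁ B₁ n) :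
    SCNearGorenstein (Δ \ (Δ₁ \ B₁)) B₁ n := by
  obtain ⟨hmem₁, hsub₁, hcard₁, -, hBΔ₁, hB, hGB, -⟩ := id h₁
  have hBΔ₂ : B₁ ⊆ Δ \ (Δ₁ \ B₁) := fun y hy => ⟨hsub (hBΔ₁ hy), fun h => h.2 hy⟩
  have hup : ∀ z ∈ Δ₁ \ B₁, ∀ y ∈ Δ, z ⊆ y → y ∈ Δ₁ \ B₁ := by
    intro z hz y hy hzy
    obtain ⟨c, hc, hc0, hne⟩ := exists_ne_zero_of_finrank_ker_eq_one (h₁.finrank_ker hz.1 hz.2)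
    obtain ⟨w, hw, hyw, hwn⟩ := hΔ.exists_facet hy
    have hcw := hΔ.cycle_apply_ne_zero z (hsub hz.1) (scCell_mono hsub z n hc) hc0 hne hw
      (hzy.trans hyw) hwn
    exact ⟨hsub₁ w (mem_scCell.1 hc w hcw).1 y hyw, fun hyB => hz.2 (hB y hyB z hzy)⟩
  have hdown : ∀ y ∈ Δ \ (Δ₁ \ B₁), ∀ z ⊆ y, z ∈ Δ \ (Δ₁ \ B₁) := fun y hy z hzy =>
    ⟨hΔ.2.1 y hy.1 z hzy, fun hz => hy.2 (hup z hz y hy.1 hzy)⟩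
  refine ⟨hBΔ₂ hGB.1, hdown, fun y hy => hΔ.2.2.1 y hy.1, ?_, hBΔ₂, hB, hGB, ?_⟩
  · by_contra! hno
    obtain ⟨c, hc, hc0, hne⟩ := exists_ne_zero_of_finrank_ker_eq_one (hΔ.finrank_ker hΔ.1)
    refine hne (h₁.cycle_eq_zero hGB.1 (mem_scCell.2 fun y hy => ?_) hc0)
    obtain ⟨hyΔ, hxy, hyn⟩ := mem_scCell.1 hc y hy
    refine ⟨?_, hxy, hyn⟩
    by_contra hy₁
    exact hno y ⟨hyΔ, fun h => hy₁ h.1⟩ hyn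
  intro x hx k
  by_cases hxB : x ∈ B₁
  swap
  · have hx₁ : x ∉ Δ₁ := fun h => hx.2 ⟨h, hxB⟩
    have hcell : ∀ k, scCell (Δ \ (Δ₁ \ B₁)) x k = scCell Δ x k := fun k =>
      le_antisymm (scCell_mono Set.sdiff_subset x k) fun f hf => mem_scCell.2 fun y hy =>
        have ⟨h1, h2, h3⟩ := mem_scCell.1 hf y hy
        ⟨⟨h1, fun h => hx₁ (hsub₁ y h.1 x h2)⟩, h2, h3⟩
    rw [hcell, hcell]
    simpa [hxB] using hΔ.2.2.2.2 x hx.1 k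
  have hx₁ : x ∈ Δ₁ := hBΔ₁ hxB
  rw [if_neg fun h => h.2 hxB, add_zero, finrank_ker_eq_iff hdown]
  have htop : ∀ c ∈ scCell (Δ \ (Δ₁ \ B₁)) x n, bnd x c = 0 → c = 0 := by
    intro c hc hc0
    by_contra hne
    obtain ⟨w, hw, hxw, hwn⟩ := h₁.exists_facet hx₁
    have hcw := hΔ.cycle_apply_ne_zero x hx.1 (scCell_mono Set.sdiff_subset x n hc) hc0 hne
      (hsub hw) hxw hwn
    exact (mem_scCell.1 hc w hcw).1.2 ⟨hw, fun hwB => (h₁.card_lt hwB).ne hwn⟩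
  have hsplit : ∀ k, ∀ d ∈ scCell Δ x k, ∃ d₁ ∈ scCell Δ₁ x k,
      ∃ d₂ ∈ scCell (Δ \ (Δ₁ \ B₁)) x k, d₁ + d₂ = d := by
    intro k d hd
    refine ⟨d.filter (· ∈ Δ₁), mem_scCell.2 fun y hy => ?_, d.filter (· ∉ Δ₁),
      mem_scCell.2 fun y hy => ?_, Finsupp.filter_add_filter_not d _⟩
    · have hp : y ∈ Δ₁ := by
        by_contra hp
        exact hy (Finsupp.filter_apply_neg (· ∈ Δ₁) d hp)
      have hdy : d y ≠ 0 := by rwa [Finsupp.filter_apply_pos (· ∈ Δ₁) d hp] at hy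
      exact ⟨hp, (mem_scCell.1 hd y hdy).2⟩
    · have hp : y ∉ Δ₁ := by
        by_contra hp
        exact hy (Finsupp.filter_apply_neg (· ∉ Δ₁) d (not_not_intro hp))
      have hdy : d y ≠ 0 := by rwa [Finsupp.filter_apply_pos (· ∉ Δ₁) d hp] at hy
      have hdy' := mem_scCell.1 hd y hdy
      exact ⟨⟨hdy'.1, fun h => hp h.1⟩, hdy'.2⟩
  have hinter : ∀ k, ∀ f ∈ scCell Δ₁ x k, f ∈ scCell (Δ \ (Δ₁ \ B₁)) x k →
      f ∈ scCell B₁ x k := by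
    intro k f hf hf'
    refine mem_scCell.2 fun y hy => ⟨?_, (mem_scCell.1 hf y hy).2⟩
    by_contra hyB
    exact (mem_scCell.1 hf' y hy).1.2 ⟨(mem_scCell.1 hf y hy).1, hyB⟩
  intro c hc hc0
  by_cases hkn : k = n
  · subst hkn
    exact ⟨0, Submodule.zero_mem _, by rw [map_zero, htop c hc hc0]⟩
  obtain ⟨d, hd, hdc⟩ := hΔ.exact hx.1 hkn c (scCell_mono Set.sdiff_subset x k hc) hc0
  obtain ⟨d₁, hd₁, d₂, hd₂, rfl⟩ := hsplit _ d hd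
  rw [map_add] at hdc
  have hd₁B : bnd x d₁ ∈ scCell B₁ x k := by
    refine hinter k _ (bnd_mem_scCell hsub₁ hd₁) ?_
    rw [eq_sub_of_add_eq hdc]
    exact Submodule.sub_mem _ hc (bnd_mem_scCell hdown hd₂)
  suffices h : ∃ e ∈ scCell (Δ \ (Δ₁ \ B₁)) x (k + 1), bnd x e = bnd x d₁ by
    obtain ⟨e, he, hed⟩ := h
    exact ⟨e + d₂, Submodule.add_mem _ he hd₂, by rw [map_add, hed, hdc]⟩
  by_cases hkn' : k = n - 1
  swap
  · obtain ⟨e, he, hed⟩ := hGB.exact hxB hkn' _ hd₁B (bnd_bnd x d₁)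
    exact ⟨e, scCell_mono hBΔ₂ x _ he, hed⟩
  have hk : k + 1 = n := by
    have := h₁.pos
    omega
  obtain ⟨z, hz, hz0, hzne⟩ := exists_ne_zero_of_finrank_ker_eq_one (hΔ.finrank_ker hx.1)
  obtain ⟨z₁, hz₁, z₂, hz₂, rfl⟩ := hsplit n z hz
  rw [map_add] at hz0
  have hz₁₂ : bnd x z₁ = -bnd x z₂ := eq_neg_of_add_eq_zero_left hz0
  have hz₁B : bnd x z₁ ∈ scCell B₁ x k := by
    refine hinter k _ (bnd_mem_scCell hsub₁ (hk ▸ hz₁)) ?_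
    rw [hz₁₂]
    exact Submodule.neg_mem _ (bnd_mem_scCell hdown (hk ▸ hz₂))
  have hz₁ne : bnd x z₁ ≠ 0 := by
    intro h0
    rw [h0, zero_add] at hz0
    exact hzne (by rw [htop z₂ hz₂ hz0, h₁.cycle_eq_zero hxB hz₁ h0, add_zero])
  obtain ⟨t, ht⟩ := exists_smul_eq_of_finrank_ker_eq_one (hkn' ▸ hGB.finrank_ker hxB) hz₁B
    (bnd_bnd x z₁) hz₁ne hd₁B (bnd_bnd x d₁)
  refine ⟨-(t • z₂), Submodule.neg_mem _ (Submodule.smul_mem _ t (hk ▸ hz₂)), ?_⟩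
  rw [← ht, hz₁₂, map_neg, map_smul, smul_neg]

end SimplicialComplexes
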